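/- Let S ⊆ ℕ be a numerical semigroup with conductor c, S ≠ ℕ, and suppose S is symmetric: for every integer z with 0 ≤ z ≤ c − 1, z ∈ S if and only if c − 1 − z ∉ S. Then the set S \ { s + c − 1 : s ∈ S } has exactly c elements. -/

import Mathlib

/-- A symmetric numerical semigroup `S ≠ ℕ` with conductor `c` satisfies
`#(S \ (S + c - 1)) = c`. -/
theorem stmt_11 (S : Set ℕ) (c : ℕ)
    (hzero : 0 ∈ S) (hadd : ∀ a ∈ S, ∀ b ∈ S, a + b ∈ S)
    (hfin : (Set.univ \ S).Finite) (hne : S ≠ Set.univ)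
    (hc : ∀ n : ℕ, c ≤ n → n ∈ S)
    (hmin : ∀ c' : ℕ, (∀ n : ℕ, c' ≤ n → n ∈ S) → c ≤ c')
    (hsym : ∀ z : ℕ, z ≤ c - 1 → (z ∈ S ↔ c - 1 - z ∉ S)) :
    (S \ ((fun s => s + c - 1) '' S)).ncard = c := by
  classical
  have hF : c - 1 ∉ S := by
    have h := (hsym 0 (Nat.zero_le _)).1 hzero
    simpa using h
  have hc1 : 1 ≤ c := by
    rcases Nat.eq_zero_or_pos c with h | h
    · subst h
      exact absurd hzero (by simpa using hF)
    · exact h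
  have key : S \ ((fun s => s + c - 1) '' S)
      = (fun z => if z ∈ S then z else z + c - 1) '' (Finset.range c : Set ℕ) := by
    ext n
    simp only [Set.mem_diff, Set.mem_image, Finset.coe_range, Set.mem_Iio]
    constructor
    · rintro ⟨hn, hn2⟩
      by_cases h : n < c
      · exact ⟨n, h, by simp [hn]⟩
      · have hg : n - (c - 1) ∉ S := fun hs => hn2 ⟨_, hs, by omega⟩
        refine ⟨n - (c - 1), ?_, ?_⟩
        · by_contra h2
          exact hg (hc _ (by omega))
        · rw [if_neg hg]; omega
    · rintro ⟨z, hz, rfl⟩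
      by_cases h : z ∈ S
      · rw [if_pos h]
        refine ⟨h, ?_⟩
        rintro ⟨s, hs, he⟩
        have : z = c - 1 := by omega
        exact hF (this ▸ h)
      · rw [if_neg h]
        have hz0 : z ≠ 0 := fun h0 => h (h0 ▸ hzero)
        refine ⟨hc _ (by omega), ?_⟩
        rintro ⟨s, hs, he⟩
        have : s = z := by omega
        exact h (this ▸ hs)
  rw [key, Set.ncard_image_of_injOn, Set.ncard_coe_finset, Finset.card_range]
  intro a ha b hb hab
  simp only [Finset.coe_range, Set.mem_Iio] at ha hb
  have ha0 : a ∉ S → a ≠ 0 := fun h h0 => h (h0 ▸ hzero)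
  have hb0 : b ∉ S → b ≠ 0 := fun h h0 => h (h0 ▸ hzero)
  by_cases h1 : a ∈ S <;> by_cases h2 : b ∈ S <;> simp only [h1, h2, if_true, if_false] at hab
  · exact hab
  · have := hb0 h2; omega
  · have := ha0 h1; omega
  · omega
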